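/- Let R be a Noetherian local domain of Krull dimension two that is complete with respect to its maximal ideal, whose maximal ideal is generated by two elements x and y (so R is a two-dimensional complete regular local ring), and whose residue field has characteristic different from 2. Let E be the fraction field of R, let v_y be the discrete valuation on E whose valuation ring is the localization of R at the height-one prime ideal (y), and let E_y be the completion of E with respect to v_y. Let q = Σ_{i=1}^n a_i Z_i² be a diagonal quadratic form over E such that each coefficient a_i has the form a_i = x^{r_i} y^{s_i} u_i for some integers r_i, s_i ≥ 0 and some unit u_i ∈ R^×. If q is hyperbolic over E_y, then q is hyperbolic over E. -/

import Mathlib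

/-!
STATEMENT 8: Let R be a two-dimensional complete regular local ring (a Noetherian local
domain of Krull dimension two, complete with respect to its maximal ideal, whose maximal
ideal is generated by two elements x and y) whose residue field has characteristic ≠ 2.
Let E = Frac R, let v_y be the discrete valuation on E whose valuation ring is the
localization of R at the height-one prime (y), and let E_y be the completion of E with
respect to v_y.  Let q = Σ aᵢ Zᵢ² be a diagonal quadratic form over E with
aᵢ = x^{rᵢ} y^{sᵢ} uᵢ, rᵢ, sᵢ ≥ 0, uᵢ ∈ R^×.  If q is hyperbolic over E_y then q is
hyperbolic over E.

A diagonal form of dimension n over a field L is hyperbolic if n = 2m and the form is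
equivalent, via an invertible linear change of variables over L, to the orthogonal sum of
m hyperbolic planes Z₁² − Z₂² + Z₃² − Z₄² + ⋯ + Z_{2m−1}² − Z_{2m}².
The valuation v_y is modelled as a surjective `ℤₘ₀`-valued valuation whose valuation ring
is R_{(y)} ⊆ E, and the completion E_y is modelled axiomatically.
-/

/-- `(Fv, ι, w)` is the completion of the valued field `(F, v)`:  `w` extends `v` along
`ι`, the image of `F` is dense in `Fv`, and `Fv` is complete. -/
def IsValuationCompletion {F Fv : Type*} [Field F] [Field Fv]
    (v : Valuation F (WithZero (Multiplicative ℤ))) (ι : F →+* Fv)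
    (w : Valuation Fv (WithZero (Multiplicative ℤ))) : Prop :=
  (∀ a : F, w (ι a) = v a) ∧
  (∀ x : Fv, ∀ γ : WithZero (Multiplicative ℤ), γ ≠ 0 → ∃ a : F, w (x - ι a) < γ) ∧
  (∀ s : ℕ → Fv,
    (∀ γ : WithZero (Multiplicative ℤ), γ ≠ 0 →
      ∃ N : ℕ, ∀ m ≥ N, ∀ n ≥ N, w (s m - s n) < γ) →
    ∃ l : Fv, ∀ γ : WithZero (Multiplicative ℤ), γ ≠ 0 →
      ∃ N : ℕ, ∀ n ≥ N, w (l - s n) < γ)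

/-- The diagonal quadratic form with coefficients `c` over a field `L` is *hyperbolic*:
its dimension is even, n = 2m, and it is equivalent (isometric via an invertible linear
change of variables over `L`) to Z₁² − Z₂² + ⋯ + Z_{2m−1}² − Z_{2m}². -/
def IsHyperbolicDiagonal {L : Type*} [Field L] {n : ℕ} (c : Fin n → L) : Prop :=
  ∃ m : ℕ, n = 2 * m ∧ ∃ g : (Fin n → L) ≃ₗ[L] (Fin n → L),
    ∀ z : Fin n → L, ∑ i, c i * (g z) i ^ 2 = ∑ i : Fin n, (-1 : L) ^ (i.val) * z i ^ 2

section

open Matrix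

/-- Diagonal forms with coefficients `c` and `d` are congruent. -/
def DiagCongr {L ι κ : Type*} [Field L] [Fintype ι] [Fintype κ] [DecidableEq ι] [DecidableEq κ]
    (c : ι → L) (d : κ → L) : Prop :=
  ∃ (P : Matrix ι κ L) (Q : Matrix κ ι L), P * Q = 1 ∧ Q * P = 1 ∧
    Pᵀ * diagonal c * P = diagonal d

/-- The diagonal form with coefficients `c` has a totally isotropic subspace of dimension at
least `m`. -/
def HasIsotropicSubspace {L ι : Type*} [Field L] [Fintype ι] (c : ι → L) (m : ℕ) : Prop :=
  ∃ W : Submodule L (ι → L), m ≤ Module.finrank L W ∧ ∀ z ∈ W, ∑ i, c i * z i ^ 2 = 0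

namespace DiagCongr

variable {L ι κ τ : Type*} [Field L] [Fintype ι] [Fintype κ] [Fintype τ] [DecidableEq ι]
  [DecidableEq κ] [DecidableEq τ] {c : ι → L} {d : κ → L} {e : τ → L}

theorem trans (h₁ : DiagCongr c d) (h₂ : DiagCongr d e) : DiagCongr c e := by
  obtain ⟨P, Q, hPQ, hQP, h⟩ := h₁
  obtain ⟨P', Q', hPQ', hQP', h'⟩ := h₂
  refine ⟨P * P', Q' * Q, ?_, ?_, ?_⟩
  · calc P * P' * (Q' * Q) = P * (P' * Q') * Q := by simp only [Matrix.mul_assoc]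
      _ = 1 := by rw [hPQ', Matrix.mul_one, hPQ]
  · calc Q' * Q * (P * P') = Q' * (Q * P) * P' := by simp only [Matrix.mul_assoc]
      _ = 1 := by rw [hQP, Matrix.mul_one, hQP']
  · rw [← h', ← h, transpose_mul]
    simp only [Matrix.mul_assoc]

theorem symm (h : DiagCongr c d) : DiagCongr d c := by
  obtain ⟨P, Q, hPQ, hQP, h⟩ := h
  refine ⟨Q, P, hQP, hPQ, ?_⟩
  calc Qᵀ * diagonal d * Q = (P * Q)ᵀ * diagonal c * (P * Q) := by
        rw [← h, transpose_mul]; simp only [Matrix.mul_assoc]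
    _ = diagonal c := by simp [hPQ]

theorem scale (c t : ι → L) (ht : ∀ i, t i ≠ 0) : DiagCongr c fun i => c i * t i ^ 2 := by
  refine ⟨diagonal t, diagonal fun i => (t i)⁻¹, ?_, ?_, ?_⟩
  · simp [ht]
  · simp [ht]
  · simp only [diagonal_transpose, diagonal_mul_diagonal]
    congr 1; ext i; ring

theorem refl (c : ι → L) : DiagCongr c c := by
  simpa using scale c 1 (by simp)

theorem reindex (c : ι → L) (σ : κ ≃ ι) : DiagCongr c (c ∘ σ) := by
  refine ⟨(1 : Matrix ι ι L).submatrix id σ, (1 : Matrix ι ι L).submatrix σ id, ?_, ?_, ?_⟩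
  · rw [Matrix.submatrix_mul_equiv]; simp
  · rw [Matrix.submatrix_mul _ _ _ _ _ Function.bijective_id |>.symm]; simp
  · ext i j
    by_cases hij : i = j <;> simp [Matrix.mul_apply, diagonal_apply, Matrix.one_apply, hij]

theorem map {M : Type*} [Field M] (φ : L →+* M) (h : DiagCongr c d) :
    DiagCongr (fun i => φ (c i)) fun i => φ (d i) := by
  obtain ⟨P, Q, hPQ, hQP, h⟩ := h
  refine ⟨P.map φ, Q.map φ, ?_, ?_, ?_⟩
  · rw [← Matrix.map_mul, hPQ]; simp
  · rw [← Matrix.map_mul, hQP]; simp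
  · have := congrArg (fun A => A.map φ) h
    simpa [Matrix.map_mul, diagonal_map, Matrix.transpose_map, Function.comp_def] using this

theorem sum_elim {ι' κ' : Type*} [Fintype ι'] [DecidableEq ι'] [Fintype κ'] [DecidableEq κ']
    {c' : ι' → L} {d' : κ' → L} (h : DiagCongr c d) (h' : DiagCongr c' d') :
    DiagCongr (Sum.elim c c') (Sum.elim d d') := by
  obtain ⟨P, Q, hPQ, hQP, h⟩ := h
  obtain ⟨P', Q', hPQ', hQP', h'⟩ := h'
  refine ⟨fromBlocks P 0 0 P', fromBlocks Q 0 0 Q', ?_, ?_, ?_⟩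
  · simp [fromBlocks_multiply, hPQ, hPQ']
  · simp [fromBlocks_multiply, hQP, hQP']
  · rw [← fromBlocks_diagonal c c', ← fromBlocks_diagonal d d', fromBlocks_transpose,
      fromBlocks_multiply, fromBlocks_multiply]
    simp [h, h']

theorem binary {α β p q : L} (h : α * p ^ 2 + β * q ^ 2 ≠ 0) :
    DiagCongr ![α, β] ![α * p ^ 2 + β * q ^ 2, α * β * (α * p ^ 2 + β * q ^ 2)] := by
  set γ := α * p ^ 2 + β * q ^ 2 with hγ
  refine ⟨!![p, -β * q; q, α * p], γ⁻¹ • !![α * p, β * q; -q, p], ?_, ?_, ?_⟩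
  · ext i j
    fin_cases i <;> fin_cases j <;> simp [Matrix.mul_apply, Fin.sum_univ_two] <;> field_simp <;>
      grind
  · ext i j
    fin_cases i <;> fin_cases j <;> simp [Matrix.mul_apply, Fin.sum_univ_two] <;> field_simp <;>
      grind
  · ext i j
    fin_cases i <;> fin_cases j <;>
      simp [Matrix.mul_apply, Fin.sum_univ_two, diagonal_apply] <;> grind

theorem _root_.dotProduct_diagonal_mulVec (c z : ι → L) :
    z ⬝ᵥ (diagonal c *ᵥ z) = ∑ i, c i * z i ^ 2 := by
  simp only [dotProduct, mulVec_diagonal]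
  exact Finset.sum_congr rfl fun i _ => by ring

theorem _root_.sum_mulVec_sq {P : Matrix ι κ L} (h : Pᵀ * diagonal c * P = diagonal d)
    (z : κ → L) : ∑ i, c i * (P *ᵥ z) i ^ 2 = ∑ i, d i * z i ^ 2 := by
  rw [← dotProduct_diagonal_mulVec, ← dotProduct_diagonal_mulVec, ← h, ← Matrix.mulVec_mulVec,
    ← Matrix.mulVec_mulVec, Matrix.mulVec_transpose, dotProduct_comm z, ← dotProduct_mulVec,
    dotProduct_comm]

theorem hasIsotropicSubspace {m : ℕ} (h : DiagCongr c d) (hc : HasIsotropicSubspace c m) :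
    HasIsotropicSubspace d m := by
  obtain ⟨Q, P, -, hPQ, h⟩ := h.symm
  obtain ⟨W, hW, hW0⟩ := hc
  have hinj : Function.Injective (Matrix.mulVecLin Q) := by
    refine Function.LeftInverse.injective (g := Matrix.mulVecLin P) fun z => ?_
    simp [hPQ]
  refine ⟨W.map (Matrix.mulVecLin Q), ?_, ?_⟩
  · rwa [← (Submodule.equivMapOfInjective _ hinj W).finrank_eq]
  · rintro _ ⟨z, hz, rfl⟩
    rw [Matrix.mulVecLin_apply, sum_mulVec_sq h]
    exact hW0 z hz

end DiagCongr

end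

/-- Splitting a finite type at two distinct elements. -/
noncomputable def sumSubtypeEquiv {ι : Type*} [DecidableEq ι] {i j : ι} (hij : i ≠ j) :
    Fin 2 ⊕ {k // k ≠ i ∧ k ≠ j} ≃ ι :=
  Equiv.ofBijective (Sum.elim ![i, j] Subtype.val) <| by
    constructor
    · rintro (a | ⟨a, ha⟩) (b | ⟨b, hb⟩) h
      · fin_cases a <;> fin_cases b <;> simp_all
      · fin_cases a
        exacts [absurd h.symm hb.1, absurd h.symm hb.2]
      · fin_cases b
        exacts [absurd h ha.1, absurd h ha.2]
      · simp_all
    · intro k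
      by_cases hi : k = i
      · exact ⟨Sum.inl 0, by simp [hi]⟩
      by_cases hj : k = j
      · exact ⟨Sum.inl 1, by simp [hj]⟩
      exact ⟨Sum.inr ⟨k, hi, hj⟩, rfl⟩

namespace DiagCongr
variable {L ι : Type*} [Field L] [Fintype ι] [DecidableEq ι]

theorem split_pair (c : ι → L) {i j : ι} (hij : i ≠ j) :
    DiagCongr c (Sum.elim ![c i, c j] fun k : {k // k ≠ i ∧ k ≠ j} => c k) := by
  convert reindex c (sumSubtypeEquiv hij) using 1
  ext (a | a)
  · fin_cases a <;> rfl
  · rfl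

theorem of_pair {c d : ι → L} {i j : ι} (hij : i ≠ j) (h : DiagCongr ![c i, c j] ![d i, d j])
    (hcd : ∀ k, k ≠ i → k ≠ j → c k = d k) : DiagCongr c d := by
  refine (split_pair c hij).trans (.trans ?_ (split_pair d hij).symm)
  convert h.sum_elim (refl fun k : {k // k ≠ i ∧ k ≠ j} => c k) using 2
  ext k
  exact (hcd k k.2.1 k.2.2).symm

theorem hyperbolic_plane (h2 : (2 : L) ≠ 0) {α t : L} (hα : α ≠ 0) (ht : t ≠ 0) :
    DiagCongr ![α, -(α * t ^ 2)] ![1, -1] := by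
  have h1 : α * ((1 + α⁻¹) / 2) ^ 2 + -(α * t ^ 2) * ((1 - α⁻¹) / (2 * t)) ^ 2 = 1 := by
    field_simp
    ring
  have := binary (α := α) (β := -(α * t ^ 2)) (p := (1 + α⁻¹) / 2) (q := (1 - α⁻¹) / (2 * t))
    (by rw [h1]; exact one_ne_zero)
  rw [h1] at this
  refine this.trans ?_
  convert scale _ ![1, (α * t)⁻¹] _ using 1
  · ext k
    fin_cases k
    · simp
    · simp; field_simp
  · intro k
    fin_cases k <;> simp [hα, ht]

end DiagCongr

theorem HasIsotropicSubspace.cancel {L κ : Type*} [Field L] [Fintype κ] (h2 : (2 : L) ≠ 0)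
    {c : κ → L} {m : ℕ} (h : HasIsotropicSubspace (Sum.elim ![1, -1] c) (m + 1)) :
    HasIsotropicSubspace c m := by
  obtain ⟨W, hW, hW0⟩ := h
  have hform : ∀ z ∈ W, z (.inl 0) ^ 2 - z (.inl 1) ^ 2 + ∑ k, c k * z (.inr k) ^ 2 = 0 := by
    intro z hz
    have := hW0 z hz
    simpa [Fintype.sum_sum_type, Fin.sum_univ_two, sub_eq_add_neg] using this
  let e : Fin 2 ⊕ κ → L := Sum.elim 1 0
  obtain ⟨μ, hμ⟩ : ∃ μ : (Fin 2 ⊕ κ → L) →ₗ[L] L, ∀ z ∈ W, μ z = 0 →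
      z (.inl 0) = z (.inl 1) ∧ ((∀ k, z (.inr k) = 0) → z = 0) := by
    by_cases he : e ∈ W
    · have h01 : ∀ z ∈ W, z (.inl 0) = z (.inl 1) := by
        intro z hz
        have h1 := hform z hz
        have h3 := hform (z + e) (W.add_mem hz he)
        simp only [e, Pi.add_apply, Sum.elim_inl, Sum.elim_inr, Pi.one_apply, Pi.zero_apply,
          add_zero] at h3
        have : (2 : L) * (z (.inl 0) - z (.inl 1)) = 0 := by linear_combination h3 - h1
        simpa [h2, sub_eq_zero] using this
      refine ⟨LinearMap.proj (.inl 0), fun z hz h0 => ⟨h01 z hz, fun hk => ?_⟩⟩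
      have h0' : z (.inl 0) = 0 := h0
      ext (k | k)
      · fin_cases k
        · exact h0'
        · exact (h01 z hz).symm.trans h0'
      · exact hk k
    · refine ⟨LinearMap.proj (.inl 0) - LinearMap.proj (.inl 1), fun z hz h0 => ?_⟩
      have h01 : z (.inl 0) = z (.inl 1) := by simpa [sub_eq_zero] using h0
      refine ⟨h01, fun hk => ?_⟩
      have hze : z = z (.inl 0) • e := by
        ext (k | k)
        · fin_cases k <;> simp [e, h01]
        · simp [e, hk]
      by_cases hz0 : z (.inl 0) = 0
      · rw [hze, hz0, zero_smul]
      · refine absurd ?_ he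
        rw [hze] at hz
        exact (W.smul_mem_iff hz0).1 hz
  let μW := μ.domRestrict W
  let g : LinearMap.ker μW →ₗ[L] (κ → L) :=
    LinearMap.funLeft L L Sum.inr ∘ₗ W.subtype ∘ₗ (LinearMap.ker μW).subtype
  have hg : Function.Injective g := by
    rw [injective_iff_map_eq_zero]
    rintro ⟨⟨z, hz⟩, hzμ⟩ hgz
    have := (hμ z hz hzμ).2 fun k => congrFun hgz k
    simpa using this
  refine ⟨LinearMap.range g, ?_, ?_⟩
  · rw [LinearMap.finrank_range_of_inj hg]
    have h1 : Module.finrank L (LinearMap.range μW) + Module.finrank L (LinearMap.ker μW) =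
        Module.finrank L W := μW.finrank_range_add_finrank_ker
    have h3 : Module.finrank L (LinearMap.range μW) ≤ 1 := by
      simpa using Submodule.finrank_le (LinearMap.range μW)
    omega
  · rintro _ ⟨⟨⟨z, hz⟩, hzμ⟩, rfl⟩
    have h1 := hform z hz
    rw [(hμ z hz hzμ).1, sub_self, zero_add] at h1
    exact h1

/-- The coefficients `1, -1, 1, -1, …` of the standard hyperbolic form. -/
def hyperbolicCoeff (L : Type*) [Field L] (n : ℕ) (i : Fin n) : L := (-1) ^ (i : ℕ)

theorem DiagCongr.hyperbolicCoeff_succ (L : Type*) [Field L] (m : ℕ) :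
    DiagCongr (Sum.elim ![1, -1] (hyperbolicCoeff L (2 * m))) (hyperbolicCoeff L (2 * (m + 1))) := by
  refine (DiagCongr.symm ?_)
  have hn : 2 + 2 * m = 2 * (m + 1) := by ring
  convert DiagCongr.reindex (hyperbolicCoeff L (2 * (m + 1))) (finSumFinEquiv.trans (finCongr hn))
    using 1
  ext (k | k)
  · fin_cases k <;> simp [hyperbolicCoeff]
  · simp [hyperbolicCoeff, pow_add]

theorem hasIsotropicSubspace_hyperbolicCoeff (L : Type*) [Field L] (m : ℕ) :
    HasIsotropicSubspace (hyperbolicCoeff L (2 * m)) m := by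
  let g : (Fin m → L) →ₗ[L] (Fin (2 * m) → L) :=
    LinearMap.funLeft L L fun i => ⟨i / 2, by omega⟩
  have hg : Function.Injective g := LinearMap.funLeft_injective_of_surjective _ _ _ fun k =>
    ⟨⟨2 * k, by omega⟩, by ext; simp⟩
  refine ⟨LinearMap.range g, by simp [LinearMap.finrank_range_of_inj hg], ?_⟩
  rintro _ ⟨z, rfl⟩
  have key : ∀ (f : ℕ → L) (m : ℕ), ∑ i ∈ Finset.range (2 * m), (-1) ^ i * f (i / 2) ^ 2 = 0 := by
    intro f m
    induction m with
    | zero => simp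
    | succ k ih =>
      rw [show 2 * (k + 1) = 2 * k + 1 + 1 by ring, Finset.sum_range_succ, Finset.sum_range_succ,
        ih, show (2 * k + 1) / 2 = k by omega, show 2 * k / 2 = k by omega, pow_succ (-1 : L), pow_mul]
      simp
  rw [← key (fun j => if h : j < m then z ⟨j, h⟩ else 0) m, Finset.sum_range]
  refine Finset.sum_congr rfl fun i _ => ?_
  have hi : (i : ℕ) / 2 < m := by omega
  simp [hyperbolicCoeff, g, hi, LinearMap.funLeft_apply]

theorem DiagCongr.isHyperbolicDiagonal {L : Type*} [Field L] {m n : ℕ} {c : Fin n → L}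
    (hn : n = 2 * m) (h : DiagCongr c (hyperbolicCoeff L n)) : IsHyperbolicDiagonal c := by
  obtain ⟨P, Q, hPQ, hQP, h⟩ := h
  refine ⟨m, hn, Matrix.toLin'OfInv hQP hPQ, fun z => ?_⟩
  exact sum_mulVec_sq h z

theorem IsHyperbolicDiagonal.hasIsotropicSubspace {L : Type*} [Field L] {m n : ℕ} {c : Fin n → L}
    (hn : n = 2 * m) (h : IsHyperbolicDiagonal c) : HasIsotropicSubspace c m := by
  obtain ⟨-, -, g, hg⟩ := h
  subst hn
  obtain ⟨W, hW, hW0⟩ := hasIsotropicSubspace_hyperbolicCoeff L m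
  refine ⟨W.map g.toLinearMap, by rwa [LinearEquiv.finrank_map_eq], ?_⟩
  rintro _ ⟨z, hz, rfl⟩
  exact (hg z).trans (hW0 z hz)

section Local

open IsLocalRing

variable {R : Type*} [CommRing R] [IsLocalRing R]

theorem isUnit_two_of_ringChar_residueField (h : ringChar (ResidueField R) ≠ 2) :
    IsUnit (2 : R) := by
  rw [← residue_ne_zero_iff_isUnit, map_ofNat]
  exact Ring.two_ne_zero h

theorem exists_sq_eq_of_sub_sq_mem [HenselianRing R (maximalIdeal R)] (h2 : IsUnit (2 : R))
    {a : R} {e : Rˣ} (h : a - e ^ 2 ∈ maximalIdeal R) : ∃ t : R, t ^ 2 = a := by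
  obtain ⟨t, ht, -⟩ := HenselianRing.is_henselian (I := maximalIdeal R)
    (Polynomial.X ^ 2 - Polynomial.C a) (Polynomial.monic_X_pow_sub_C a two_ne_zero) (e : R)
    (by simpa using (maximalIdeal R).neg_mem h)
    (by
      refine IsUnit.map _ ?_
      simpa [one_add_one_eq_two] using h2.mul e.isUnit)
  refine ⟨t, ?_⟩
  simpa [sub_eq_zero] using ht

theorem DiagCongr.exists_hyperbolic_pair [HenselianRing R (maximalIdeal R)] (h2 : IsUnit (2 : R))
    {F ι : Type*} [Field F] [Fintype ι] [DecidableEq ι] (φ : R →+* F) {b : F} (hb : b ≠ 0)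
    (J : Finset ι) (c : ι → F) (u e : ι → Rˣ) (hJ : J.Nonempty)
    (hc : ∀ i ∈ J, c i = b * φ (u i)) (hsum : ∑ i ∈ J, (u i : R) * (e i : R) ^ 2 ∈ maximalIdeal R) :
    ∃ c' : ι → F, DiagCongr c c' ∧ (∀ k, ∃ w : Rˣ, c' k = c k * φ w) ∧
      ∃ i j, i ≠ j ∧ c' i ≠ 0 ∧ ∃ t, t ≠ 0 ∧ c' j = -(c' i * t ^ 2) := by
  have hφ : ∀ w : Rˣ, φ w ≠ 0 := fun w => (w.isUnit.map φ).ne_zero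
  induction hN : J.card generalizing J c u e with
  | zero => simp_all
  | succ N ih =>
  obtain ⟨i, hi⟩ := hJ
  have hJ1 : ∃ j ∈ J, j ≠ i := by
    by_contra! h
    have hJi : J = {i} := Finset.eq_singleton_iff_unique_mem.2 ⟨hi, h⟩
    rw [hJi, Finset.sum_singleton] at hsum
    exact hsum (by simp)
  obtain ⟨j, hj, hji⟩ := hJ1
  by_cases hunit : IsUnit ((u i : R) * (e i : R) ^ 2 + u j * (e j : R) ^ 2)
  · obtain ⟨γ, hγ⟩ := hunit
    let w : ι → Rˣ := fun k => if k = i then γ / u i else if k = j then u i * γ else 1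
    have hwi : w i = γ / u i := by simp [w]
    have hwj : w j = u i * γ := by simp [w, hji]
    have hwk : ∀ k, k ≠ i → k ≠ j → w k = 1 := fun k h h' => by simp [w, h, h']
    have hci : c i * φ (w i) = b * φ γ := by
      rw [hc i hi, hwi, mul_assoc, ← map_mul, ← Units.val_mul, mul_div_cancel]
    have hcong : DiagCongr c fun k => c k * φ (w k) := by
      refine of_pair hji.symm ?_ fun k h h' => by simp [hwk k h h']
      have hγ' : c i * φ (e i) ^ 2 + c j * φ (e j) ^ 2 = b * φ γ := by
        rw [hγ, hc i hi, hc j hj]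
        simp only [map_add, map_mul, map_pow]
        ring
      have hbin := binary (α := c i) (β := c j) (p := φ (e i)) (q := φ (e j))
        (by rw [hγ']; exact mul_ne_zero hb (hφ γ))
      rw [hγ'] at hbin
      refine hbin.trans ?_
      convert scale _ ![1, b⁻¹] _ using 1
      · ext k
        fin_cases k
        · simp [hci]
        · simp [hwj, hc i hi, hc j hj]
          field_simp
      · intro k
        fin_cases k <;> simp [hb]
    have hsum' : ∑ k ∈ J.erase j, ((u k * w k : Rˣ) : R) *
        ((if k = i then 1 else e k : Rˣ) : R) ^ 2 ∈ maximalIdeal R := by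
      have hi' : i ∈ J.erase j := Finset.mem_erase.2 ⟨hji.symm, hi⟩
      convert hsum using 1
      rw [← Finset.add_sum_erase J _ hj, ← Finset.add_sum_erase _ _ hi',
        ← Finset.add_sum_erase _ _ hi', ← add_assoc]
      congr 1
      · rw [hwi, mul_div_cancel, if_pos rfl, hγ]
        simp [add_comm]
      · refine Finset.sum_congr rfl fun k hk => ?_
        simp only [Finset.mem_erase] at hk
        rw [hwk k hk.1 hk.2.1, if_neg hk.1, mul_one]
    obtain ⟨c', hc', hform, hpair⟩ := ih (J.erase j) (fun k => c k * φ (w k)) (fun k => u k * w k)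
      (fun k => if k = i then 1 else e k) ⟨i, Finset.mem_erase.2 ⟨hji.symm, hi⟩⟩
      (fun k hk => by rw [hc k (Finset.mem_of_mem_erase hk), Units.val_mul, map_mul, mul_assoc])
      hsum' (by rw [Finset.card_erase_of_mem hj, hN]; rfl)
    refine ⟨c', hcong.trans hc', fun k => ?_, hpair⟩
    obtain ⟨w', hw'⟩ := hform k
    exact ⟨w k * w', by rw [hw', Units.val_mul, map_mul, mul_assoc]⟩
  · have hmem : -((u j : R) * ((u i)⁻¹ : Rˣ)) - ((e i / e j : Rˣ) : R) ^ 2 ∈ maximalIdeal R := by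
      have := (maximalIdeal R).mul_mem_left (-(((u i)⁻¹ : Rˣ) * ((e j)⁻¹ : Rˣ) ^ 2 : R)) hunit
      convert this using 1
      have h1 : ((u i)⁻¹ : Rˣ) * (u i : R) = 1 := Units.inv_mul _
      have h3 : ((e j)⁻¹ : Rˣ) * (e j : R) = 1 := Units.inv_mul _
      rw [div_eq_mul_inv, Units.val_mul]
      linear_combination (((e i : R) * ((e j)⁻¹ : Rˣ)) ^ 2) * h1 +
        ((u j : R) * ((u i)⁻¹ : Rˣ)) * (((e j)⁻¹ : Rˣ) * (e j : R) + 1) * h3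
    obtain ⟨t, ht⟩ := exists_sq_eq_of_sub_sq_mem h2 hmem
    have htu : IsUnit t := by
      have : IsUnit (t ^ 2) := by
        rw [ht, ← Units.val_mul]
        exact (Units.isUnit _).neg
      exact (isUnit_pow_iff two_ne_zero).1 this
    refine ⟨c, refl c, fun k => ⟨1, by simp⟩, i, j, hji.symm, ?_, φ t, (htu.map φ).ne_zero, ?_⟩
    · rw [hc i hi]
      exact mul_ne_zero hb (hφ _)
    · rw [hc i hi, hc j hj, ← map_pow, ht, mul_assoc, ← map_mul, ← mul_neg, ← map_neg]
      congr 2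
      rw [mul_neg, neg_neg, mul_left_comm, Units.mul_inv, mul_one]

end Local

/-- Splitting off a hyperbolic plane whose two coefficients are `α` and `-α t²`. -/
theorem DiagCongr.split_hyperbolic {L ι : Type*} [Field L] [Fintype ι] [DecidableEq ι]
    (h2 : (2 : L) ≠ 0) {c : ι → L} {i j : ι} (hij : i ≠ j) (hi : c i ≠ 0) {t : L} (ht : t ≠ 0)
    (hj : c j = -(c i * t ^ 2)) :
    DiagCongr c (Sum.elim ![1, -1] fun k : {k // k ≠ i ∧ k ≠ j} => c k) := by
  refine (split_pair c hij).trans (sum_elim ?_ (refl _))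
  rw [hj]
  exact hyperbolic_plane h2 hi ht

theorem diagCongr_hyperbolicCoeff_of_hasIsotropicSubspace {R F G : Type*} [CommRing R]
    [IsLocalRing R] [HenselianRing R (IsLocalRing.maximalIdeal R)] [Field F] [Field G]
    (h2 : IsUnit (2 : R)) (φ : R →+* F) (ψ : F →+* G) (x y : R) (hx : φ x ≠ 0) (hy : φ y ≠ 0)
    (H : ∀ (ι : Type) [Fintype ι] (r s : ι → ℕ) (u : ι → Rˣ), (∀ i, r i < 2) → (∀ i, s i < 2) →
      (∃ z : ι → G, z ≠ 0 ∧ ∑ i, ψ (φ (x ^ r i * y ^ s i * u i)) * z i ^ 2 = 0) →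
      ∃ (J : Finset ι) (e : ι → Rˣ), J.Nonempty ∧ (∀ i ∈ J, ∀ j ∈ J, r i = r j ∧ s i = s j) ∧
        ∑ i ∈ J, (u i : R) * (e i : R) ^ 2 ∈ IsLocalRing.maximalIdeal R)
    (m : ℕ) (ι : Type) [Fintype ι] [DecidableEq ι] (hcard : Fintype.card ι = 2 * m) (c : ι → F)
    (hc : ∀ i, ∃ (r s : ℕ) (u : Rˣ), r < 2 ∧ s < 2 ∧ c i = φ (x ^ r * y ^ s * u))
    (hiso : HasIsotropicSubspace (fun i => ψ (c i)) m) :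
    DiagCongr c (hyperbolicCoeff F (2 * m)) := by
  have h2F : (2 : F) ≠ 0 := by rw [← map_ofNat φ 2]; exact (h2.map φ).ne_zero
  have h2G : (2 : G) ≠ 0 := by rw [← map_ofNat ψ 2]; simpa using h2F
  induction m generalizing ι with
  | zero =>
    have : IsEmpty ι := Fintype.card_eq_zero_iff.1 (by simpa using hcard)
    have : IsEmpty (Fin (2 * 0)) := Fin.isEmpty
    convert DiagCongr.reindex c (Equiv.equivOfIsEmpty (Fin (2 * 0)) ι) using 1
  | succ m ih =>
    choose r s u hr hs hcu using hc
    obtain ⟨z, hz, hz0⟩ : ∃ z : ι → G, z ≠ 0 ∧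
        ∑ i, ψ (φ (x ^ r i * y ^ s i * u i)) * z i ^ 2 = 0 := by
      obtain ⟨W, hW, hW0⟩ := hiso
      have hWbot : W ≠ ⊥ := by
        rintro rfl
        simp at hW
      obtain ⟨z, hzW, hz⟩ := Submodule.exists_mem_ne_zero_of_ne_bot hWbot
      exact ⟨z, hz, by simpa only [hcu] using hW0 z hzW⟩
    obtain ⟨J, e, ⟨i₀, hi₀⟩, hJ, hsum⟩ := H ι r s u hr hs ⟨z, hz, hz0⟩
    obtain ⟨c', hcc', hform, i, j, hij, hi, t, ht, hj⟩ :=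
      DiagCongr.exists_hyperbolic_pair h2 φ (b := φ (x ^ r i₀ * y ^ s i₀))
        (by simp [hx, hy]) J c u e ⟨i₀, hi₀⟩
        (fun k hk => by
          rw [hcu, (hJ k hk i₀ hi₀).1, (hJ k hk i₀ hi₀).2, map_mul])
        hsum
    have hsplit := hcc'.trans (DiagCongr.split_hyperbolic h2F hij hi ht hj)
    have hiso' := hsplit.map ψ |>.hasIsotropicSubspace hiso
    have hiso'' : HasIsotropicSubspace (fun k : {k // k ≠ i ∧ k ≠ j} => ψ (c' k)) m := by
      refine HasIsotropicSubspace.cancel h2G ?_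
      convert hiso' using 1
      ext (k | k)
      · fin_cases k <;> simp
      · rfl
    have hcard' : Fintype.card {k // k ≠ i ∧ k ≠ j} = 2 * m := by
      have := Fintype.card_congr (sumSubtypeEquiv hij)
      rw [Fintype.card_sum, Fintype.card_fin] at this
      omega
    refine hsplit.trans (.trans (.sum_elim (.refl _) (ih _ hcard' _ (fun k => ?_) hiso''))
      (DiagCongr.hyperbolicCoeff_succ F m))
    obtain ⟨w, hw⟩ := hform k
    exact ⟨r k, s k, u k * w, hr k, hs k, by
      rw [hw, hcu, Units.val_mul, ← map_mul, mul_assoc (x ^ r k * y ^ s k)]⟩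

/-- In a local ring with maximal ideal `(x, y)` and `(y)` prime, every element outside `(y)` is,
modulo `y`, a power of `x` times a unit. -/
theorem exists_sub_pow_mul_unit_mem {R : Type*} [CommRing R] [IsNoetherianRing R] [IsLocalRing R]
    {x y : R} (hxy : IsLocalRing.maximalIdeal R = Ideal.span {x, y})
    (hprime : (Ideal.span {y}).IsPrime) {p : R} (hp : p ∉ Ideal.span {y}) :
    ∃ (f : ℕ) (e : Rˣ), p - x ^ f * e ∈ Ideal.span {y} := by
  let π := Ideal.Quotient.mk (Ideal.span {y})
  have hp0 : π p ≠ 0 := by rwa [Ne, Ideal.Quotient.eq_zero_iff_mem]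
  have hyx : ∀ a : R, a ∈ IsLocalRing.maximalIdeal R ↔ π x ∣ π a := by
    intro a
    rw [hxy, Ideal.mem_span_pair]
    constructor
    · rintro ⟨b, c, rfl⟩
      refine ⟨π b, ?_⟩
      rw [← map_mul, Ideal.Quotient.eq, Ideal.mem_span_singleton]
      exact ⟨c, by ring⟩
    · rintro ⟨b, hb⟩
      obtain ⟨b, rfl⟩ := Ideal.Quotient.mk_surjective b
      rw [← map_mul, Ideal.Quotient.eq, Ideal.mem_span_singleton] at hb
      obtain ⟨c, hc⟩ := hb
      exact ⟨b, c, by linear_combination -hc⟩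
  have hxu : ¬IsUnit (π x) := by
    intro hu
    have := (hyx 1).2 hu.dvd
    exact this isUnit_one
  obtain ⟨f, b, hb, hpb⟩ := WfDvdMonoid.max_power_factor' hp0 (x := π x) hxu
  obtain ⟨b, rfl⟩ := Ideal.Quotient.mk_surjective b
  have hbu : IsUnit b := not_not.1 (mt (hyx b).1 hb)
  exact ⟨f, hbu.unit, by
    rw [← Ideal.Quotient.eq, hpb, map_mul, map_pow]
    rfl⟩

open scoped WithZero in
/-- The valuation ring of `v` is the localization of `R` at `(y)`. -/
def HasValuationRingAt {R : Type*} [CommRing R] [IsDomain R] (y : R)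
    (v : Valuation (FractionRing R) ℤᵐ⁰) : Prop :=
  ∀ e : FractionRing R, v e ≤ 1 ↔ ∃ p q : R, q ∉ Ideal.span {y} ∧
    algebraMap R (FractionRing R) q * e = algebraMap R (FractionRing R) p

namespace HasValuationRingAt

open scoped WithZero

variable {R : Type*} [CommRing R] [IsDomain R] {y : R} {v : Valuation (FractionRing R) ℤᵐ⁰}

local notation "A" => algebraMap R (FractionRing R)

theorem map_le_one (h : HasValuationRingAt y v) (hy : ¬IsUnit y) (p : R) : v (A p) ≤ 1 :=
  (h _).2 ⟨p, 1, by rwa [Ideal.mem_span_singleton, ← isUnit_iff_dvd_one], by simp⟩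

theorem map_eq_one (h : HasValuationRingAt y v) (hy : ¬IsUnit y) {q : R}
    (hq : q ∉ Ideal.span {y}) : v (A q) = 1 := by
  have hq0 : A q ≠ 0 := by
    rw [Ne, FaithfulSMul.algebraMap_eq_zero_iff]
    rintro rfl
    exact hq (zero_mem _)
  refine le_antisymm (h.map_le_one hy q) ?_
  have : v (A q)⁻¹ ≤ 1 := (h _).2 ⟨1, q, hq, by simp [hq0]⟩
  rw [map_inv₀] at this
  exact (inv_le_one₀ (by simpa [zero_lt_iff] using hq0)).1 this

theorem map_self_lt_one (h : HasValuationRingAt y v) (hy : ¬IsUnit y) : v (A y) < 1 := by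
  refine lt_of_le_of_ne (h.map_le_one hy y) fun h1 => ?_
  have hy0 : A y ≠ 0 := by
    intro h0
    simp [h0] at h1
  obtain ⟨p, q, hq, hqp⟩ := (h (A y)⁻¹).1 (by rw [map_inv₀, h1, inv_one])
  refine hq (Ideal.mem_span_singleton.2 ⟨p, FaithfulSMul.algebraMap_injective R (FractionRing R) ?_⟩)
  rw [map_mul, ← hqp]
  field_simp

theorem map_lt_one_iff (h : HasValuationRingAt y v) (hy : ¬IsUnit y) {p : R} :
    v (A p) < 1 ↔ p ∈ Ideal.span {y} := by
  refine ⟨fun hp => ?_, fun hp => ?_⟩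
  · by_contra hp'
    exact hp.ne (h.map_eq_one hy hp')
  · obtain ⟨t, rfl⟩ := Ideal.mem_span_singleton.1 hp
    rw [map_mul, map_mul]
    exact mul_lt_one_of_lt_of_le (h.map_self_lt_one hy) (h.map_le_one hy t)

theorem isPrime (h : HasValuationRingAt y v) (hy : ¬IsUnit y) : (Ideal.span {y}).IsPrime := by
  refine ⟨by rwa [Ne, Ideal.span_singleton_eq_top], fun {a b} hab => ?_⟩
  by_contra! hc
  have := (h.map_lt_one_iff hy).2 hab
  rw [map_mul, map_mul, h.map_eq_one hy hc.1, h.map_eq_one hy hc.2] at this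
  simp at this

theorem map_le_map_self (h : HasValuationRingAt y v) (hy : ¬IsUnit y) {e : FractionRing R}
    (he : v e < 1) : v e ≤ v (A y) := by
  obtain ⟨p, q, hq, hqp⟩ := (h e).1 he.le
  have hep : v e = v (A p) := by
    rw [← hqp, map_mul, h.map_eq_one hy hq, one_mul]
  rw [hep] at he ⊢
  obtain ⟨t, rfl⟩ := Ideal.mem_span_singleton.1 ((h.map_lt_one_iff hy).1 he)
  rw [map_mul, map_mul]
  exact mul_le_of_le_one_right' (h.map_le_one hy t)

theorem map_self (h : HasValuationRingAt y v) (hy : ¬IsUnit y) (hv : Function.Surjective v) :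
    v (A y) = WithZero.exp (-1 : ℤ) := by
  obtain ⟨e, he⟩ := hv (WithZero.exp (-1 : ℤ))
  have h1 : WithZero.exp (-1 : ℤ) ≤ v (A y) := by
    rw [← he]
    refine h.map_le_map_self hy ?_
    rw [he, ← WithZero.exp_zero, WithZero.exp_lt_exp]
    omega
  have h0 : v (A y) ≠ 0 := (lt_of_lt_of_le WithZero.exp_pos h1).ne'
  have h2 := h.map_self_lt_one hy
  rw [← WithZero.exp_log h0] at h1 h2 ⊢
  rw [← WithZero.exp_zero, WithZero.exp_lt_exp] at h2
  rw [WithZero.exp_le_exp] at h1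
  congr 1
  omega

theorem algebraMap_self_ne_zero (h : HasValuationRingAt y v) (hy : ¬IsUnit y)
    (hv : Function.Surjective v) : A y ≠ 0 := by
  intro h0
  have hvy := h.map_self hy hv
  rw [h0, map_zero] at hvy
  exact WithZero.exp_ne_zero hvy.symm

theorem exists_eq_zpow_mul (h : HasValuationRingAt y v) (hy : ¬IsUnit y)
    (hv : Function.Surjective v) {z : FractionRing R} (hz : z ≠ 0) :
    ∃ (k : ℤ) (z' : FractionRing R), v z' = 1 ∧ z = A y ^ k * z' := by
  have hvy := h.map_self hy hv
  have hy0 := h.algebraMap_self_ne_zero hy hv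
  have hvz : v z ≠ 0 := by simpa using hz
  refine ⟨-WithZero.log (v z), A y ^ WithZero.log (v z) * z, ?_, ?_⟩
  · rw [map_mul, map_zpow₀, hvy, ← WithZero.exp_zsmul]
    nth_rw 2 [← WithZero.exp_log hvz]
    rw [← WithZero.exp_add, ← WithZero.exp_zero]
    simp
  · rw [← mul_assoc, ← zpow_add₀ hy0]
    simp

theorem exists_common_denominator (h : HasValuationRingAt y v) (hy : ¬IsUnit y) {ι : Type*}
    (I : Finset ι) (z : ι → FractionRing R) (hz : ∀ i ∈ I, v (z i) ≤ 1) :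
    ∃ D : R, v (A D) = 1 ∧ ∀ i ∈ I, ∃ p : R, A D * z i = A p := by
  classical
  induction I using Finset.induction_on with
  | empty => exact ⟨1, by simp, by simp⟩
  | insert j I hj ih =>
    obtain ⟨D, hD, hDI⟩ := ih fun i hi => hz i (Finset.mem_insert_of_mem hi)
    obtain ⟨p, q, hq, hqp⟩ := (h _).1 (hz j (Finset.mem_insert_self j I))
    refine ⟨D * q, by rw [map_mul, map_mul, hD, h.map_eq_one hy hq, one_mul], fun i hi => ?_⟩
    obtain rfl | hi := Finset.mem_insert.1 hi
    · exact ⟨D * p, by rw [map_mul, map_mul, mul_assoc, hqp]⟩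
    · obtain ⟨p', hp'⟩ := hDI i hi
      exact ⟨p' * q, by rw [map_mul, map_mul, ← hp']; ring⟩

theorem exists_isotropic_residue [IsNoetherianRing R] [IsLocalRing R]
    (h : HasValuationRingAt y v) (hv : Function.Surjective v) {x : R}
    (hxy : IsLocalRing.maximalIdeal R = Ideal.span {x, y}) (hx : x ∉ Ideal.span {y})
    {ι : Type*} [Fintype ι] (r s : ι → ℕ) (u : ι → Rˣ) (hr : ∀ i, r i < 2) (hs : ∀ i, s i < 2)
    (z : ι → FractionRing R) {i₀ : ι}
    (hmax : ∀ i, v (A (x ^ r i * y ^ s i * u i) * z i ^ 2) ≤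
      v (A (x ^ r i₀ * y ^ s i₀ * u i₀) * z i₀ ^ 2))
    (hlt : v (∑ i, A (x ^ r i * y ^ s i * u i) * z i ^ 2) <
      v (A (x ^ r i₀ * y ^ s i₀ * u i₀) * z i₀ ^ 2)) :
    ∃ (J : Finset ι) (e : ι → Rˣ), J.Nonempty ∧ (∀ i ∈ J, ∀ j ∈ J, r i = r j ∧ s i = s j) ∧
      ∑ i ∈ J, (u i : R) * (e i : R) ^ 2 ∈ IsLocalRing.maximalIdeal R := by
  classical
  have hxm : x ∈ IsLocalRing.maximalIdeal R := hxy ▸ Ideal.subset_span (by simp)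
  have hym : y ∈ IsLocalRing.maximalIdeal R := hxy ▸ Ideal.subset_span (by simp)
  have hy : ¬IsUnit y := hym
  have hprime := h.isPrime hy
  have hy0 := h.algebraMap_self_ne_zero hy hv
  have hvy0 : 0 < v (A y) := by simpa [zero_lt_iff] using hy0
  set a : ι → FractionRing R := fun i => A (x ^ r i * y ^ s i * u i) * z i ^ 2 with ha
  change ∀ i, v (a i) ≤ v (a i₀) at hmax
  change v (∑ i, a i) < v (a i₀) at hlt
  have hM : v (a i₀) ≠ 0 := (lt_of_le_of_lt zero_le hlt).ne'
  let I : Finset ι := {i | v (a i) = v (a i₀)}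
  have hmemI : ∀ {i}, i ∈ I ↔ v (a i) = v (a i₀) := by simp [I]
  have hI : v (∑ i ∈ I, a i) < v (a i₀) := by
    rw [← Finset.sum_add_sum_compl I] at hlt
    rw [← add_sub_cancel_right (∑ i ∈ I, a i) (∑ i ∈ Iᶜ, a i)]
    refine v.map_sub_lt hlt (v.map_sum_lt hM fun i hi => lt_of_le_of_ne (hmax i) ?_)
    simpa [I] using hi
  have hz : ∀ i ∈ I, z i ≠ 0 := by
    intro i hi h0
    apply hM
    rw [← hmemI.1 hi]
    simp [ha, h0]
  have hz' : ∀ i, ∃ (k : ℤ) (z' : FractionRing R), i ∈ I → v z' = 1 ∧ z i = A y ^ k * z' := by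
    intro i
    by_cases hi : i ∈ I
    · obtain ⟨k, z', hkz⟩ := h.exists_eq_zpow_mul hy hv (hz i hi)
      exact ⟨k, z', fun _ => hkz⟩
    · exact ⟨0, 0, fun h => absurd h hi⟩
  choose k z' hkz using hz'
  obtain ⟨D, hD, hDI⟩ := h.exists_common_denominator hy I z' fun i hi => (hkz i hi).1.le
  have hP : ∀ i, ∃ (P : R) (f : ℕ) (e : Rˣ), i ∈ I → A D * z' i = A P ∧
      P - x ^ f * e ∈ Ideal.span {y} := by
    intro i
    by_cases hi : i ∈ I
    · obtain ⟨P, hP⟩ := hDI i hi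
      have hPy : P ∉ Ideal.span {y} := by
        rw [← h.map_lt_one_iff hy, ← hP, map_mul, hD, (hkz i hi).1]
        simp
      obtain ⟨f, e, hfe⟩ := exists_sub_pow_mul_unit_mem hxy hprime hPy
      exact ⟨P, f, e, fun _ => ⟨hP, hfe⟩⟩
    · exact ⟨0, 0, 1, fun h => absurd h hi⟩
  choose P f e hPfe using hP
  have hva : ∀ i ∈ I, v (a i) = v (A y) ^ ((s i : ℤ) + 2 * k i) := by
    intro i hi
    have hvx : v (A x) = 1 := h.map_eq_one hy hx
    have hvu : v (A (u i)) = 1 := h.map_eq_one hy fun hmem =>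
      hprime.ne_top (Ideal.eq_top_of_isUnit_mem _ hmem (u i).isUnit)
    rw [ha]
    simp only [(hkz i hi).2, map_mul, map_pow, map_zpow₀, hvx, hvu, (hkz i hi).1, one_pow, one_mul,
      mul_one]
    rw [zpow_add₀ hvy0.ne', zpow_natCast, mul_comm (2 : ℤ), zpow_mul, zpow_ofNat]
  have hi₀ : i₀ ∈ I := hmemI.2 rfl
  have hK : ∀ i ∈ I, (s i : ℤ) + 2 * k i = s i₀ + 2 * k i₀ := fun i hi =>
    zpow_right_injective₀ hvy0 (h.map_self_lt_one hy).ne <| by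
      simpa only [← hva i hi, ← hva i₀ hi₀] using hmemI.1 hi
  have hsumP : ∑ i ∈ I, x ^ r i * u i * P i ^ 2 ∈ Ideal.span {y} := by
    rw [← h.map_lt_one_iff hy]
    have heq : A D ^ 2 * ∑ i ∈ I, a i =
        A y ^ ((s i₀ : ℤ) + 2 * k i₀) * A (∑ i ∈ I, x ^ r i * u i * P i ^ 2) := by
      rw [map_sum, Finset.mul_sum, Finset.mul_sum]
      refine Finset.sum_congr rfl fun i hi => ?_
      rw [← hK i hi, ha]
      simp only [map_mul, map_pow, ← (hPfe i hi).1]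
      rw [zpow_add₀ hy0, zpow_natCast, mul_comm (2 : ℤ), zpow_mul, (hkz i hi).2]
      simp only [zpow_ofNat]
      ring
    have hveq := congrArg v heq
    rw [map_mul, map_mul, map_pow, hD, one_pow, one_mul, map_zpow₀, ← hva i₀ hi₀] at hveq
    rw [hveq] at hI
    exact (mul_lt_iff_lt_one_right (zero_lt_iff.2 hM)).1 hI
  have hsume : ∑ i ∈ I, x ^ (r i + 2 * f i) * (u i * (e i : R) ^ 2) ∈ Ideal.span {y} := by
    rw [← sub_sub_cancel (∑ i ∈ I, x ^ r i * u i * P i ^ 2)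
      (∑ i ∈ I, x ^ (r i + 2 * f i) * (u i * (e i : R) ^ 2)), ← Finset.sum_sub_distrib]
    refine sub_mem hsumP (sum_mem fun i hi => ?_)
    convert Ideal.mul_mem_left _ (x ^ r i * u i * (P i + x ^ f i * e i)) (hPfe i hi).2 using 1
    rw [pow_add, pow_mul']
    ring
  obtain ⟨i₁, hi₁, hmin⟩ := Finset.exists_min_image I (fun i => r i + 2 * f i) ⟨i₀, hi₀⟩
  have hdiv : ∑ i ∈ I, x ^ (r i + 2 * f i - (r i₁ + 2 * f i₁)) * (u i * (e i : R) ^ 2) ∈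
      Ideal.span {y} := by
    have heq : ∑ i ∈ I, x ^ (r i + 2 * f i) * (u i * (e i : R) ^ 2) = x ^ (r i₁ + 2 * f i₁) *
        ∑ i ∈ I, x ^ (r i + 2 * f i - (r i₁ + 2 * f i₁)) * (u i * (e i : R) ^ 2) := by
      rw [Finset.mul_sum]
      refine Finset.sum_congr rfl fun i hi => ?_
      rw [← mul_assoc (x ^ (r i₁ + 2 * f i₁)), ← pow_add, Nat.add_sub_cancel' (hmin i hi)]
    rw [heq] at hsume
    exact (hprime.mem_or_mem hsume).resolve_left fun hmem => hx (hprime.mem_of_pow_mem _ hmem)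
  refine ⟨I.filter fun i => r i + 2 * f i = r i₁ + 2 * f i₁, e, ⟨i₁, by simp [hi₁]⟩, ?_, ?_⟩
  · intro i hi j hj
    rw [Finset.mem_filter] at hi hj
    have h1 := hK i hi.1
    have h3 := hK j hj.1
    have := hr i
    have := hr j
    have := hs i
    have := hs j
    omega
  · have hdiv' : ∑ i ∈ I, x ^ (r i + 2 * f i - (r i₁ + 2 * f i₁)) * (u i * (e i : R) ^ 2) ∈
        IsLocalRing.maximalIdeal R := (Ideal.span_singleton_le_iff_mem _).2 hym hdiv
    rw [← Finset.sum_filter_add_sum_filter_not I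
      fun i => r i + 2 * f i = r i₁ + 2 * f i₁] at hdiv'
    convert (Submodule.add_mem_iff_left _ (sum_mem fun i hi => ?_)).1 hdiv' using 1
    · refine Finset.sum_congr rfl fun i hi => ?_
      rw [(Finset.mem_filter.1 hi).2]
      simp
    · rw [Finset.mem_filter] at hi
      have := hmin i hi.1
      exact Ideal.mul_mem_right _ _ (Ideal.pow_mem_of_mem _ hxm _ (by omega))

end HasValuationRingAt

theorem IsValuationCompletion.exists_approx {F Fv ι : Type*} [Field F] [Field Fv] [Fintype ι]
    {v : Valuation F (WithZero (Multiplicative ℤ))} {φ : F →+* Fv}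
    {w : Valuation Fv (WithZero (Multiplicative ℤ))} (h : IsValuationCompletion v φ w)
    (a : ι → F) (ha : ∀ i, a i ≠ 0) {z : ι → Fv} (hz : z ≠ 0)
    (hsum : ∑ i, φ (a i) * z i ^ 2 = 0) :
    ∃ (t : ι → F) (i₀ : ι), (∀ i, v (a i * t i ^ 2) ≤ v (a i₀ * t i₀ ^ 2)) ∧
      v (∑ i, a i * t i ^ 2) < v (a i₀ * t i₀ ^ 2) := by
  have ht : ∀ i, ∃ t : F, v t = w (z i) ∧ (z i ≠ 0 → w (z i - φ t) < w (z i)) ∧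
      (z i = 0 → t = 0) := by
    intro i
    by_cases hi : z i = 0
    · exact ⟨0, by simp [hi], fun h => absurd hi h, fun _ => rfl⟩
    · obtain ⟨t, ht⟩ := h.2.1 (z i) (w (z i)) (by simpa using hi)
      refine ⟨t, ?_, fun _ => ht, fun h => absurd h hi⟩
      rw [← h.1, ← sub_sub_cancel (z i) (φ t)]
      exact w.map_sub_eq_of_lt_left ht
  choose t htv ht ht0 using ht
  obtain ⟨j, hj⟩ := Function.ne_iff.1 hz
  have : Nonempty ι := ⟨j⟩
  obtain ⟨i₀, hi₀⟩ := Finite.exists_max fun i => v (a i * t i ^ 2)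
  refine ⟨t, i₀, hi₀, ?_⟩
  have hM : v (a i₀ * t i₀ ^ 2) ≠ 0 := by
    refine (lt_of_lt_of_le ?_ (hi₀ j)).ne'
    rw [zero_lt_iff, map_mul, map_pow, htv]
    simpa [ha j] using hj
  have heq : φ (∑ i, a i * t i ^ 2) = ∑ i, φ (a i) * (φ (t i) ^ 2 - z i ^ 2) := by
    simp only [mul_sub, Finset.sum_sub_distrib, hsum, sub_zero, map_sum, map_mul, map_pow]
  rw [← h.1, heq]
  refine w.map_sum_lt hM fun i _ => ?_
  by_cases hi : z i = 0
  · simpa [hi, ht0 i hi, zero_lt_iff] using hM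
  · refine lt_of_lt_of_le ?_ (hi₀ i)
    have hwz : 0 < w (z i) := by simpa [zero_lt_iff] using hi
    have h1 : w (φ (t i) + z i) ≤ w (z i) := by
      refine w.map_add_le ?_ le_rfl
      rw [h.1, htv]
    have h3 : w (φ (t i) - z i) < w (z i) := by
      rw [w.map_sub_swap]
      exact ht i hi
    rw [sq_sub_sq, map_mul, map_mul, map_mul, map_pow, h.1, htv, sq]
    exact mul_lt_mul_of_pos_left (mul_lt_mul_of_le_of_lt_of_nonneg_of_pos h1 h3 zero_le hwz)
      (by simpa [zero_lt_iff] using ha i)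

theorem notMem_span_singleton_of_ringKrullDim_eq_two {R : Type*} [CommRing R] [IsNoetherianRing R]
    [IsLocalRing R] {x y : R} (hxy : IsLocalRing.maximalIdeal R = Ideal.span {x, y})
    (hdim : ringKrullDim R = 2) : x ∉ Ideal.span {y} := by
  intro hx
  have hm : IsLocalRing.maximalIdeal R = Ideal.span {y} := by
    rw [hxy, Ideal.span_insert, sup_eq_right, Ideal.span_singleton_le_iff_mem]
    exact hx
  have : (IsLocalRing.maximalIdeal R).IsPrincipal := ⟨y, hm⟩
  have hle : (IsLocalRing.maximalIdeal R).height ≤ 1 :=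
    Ideal.height_le_one_of_isPrincipal_of_mem_minimalPrimes (IsLocalRing.maximalIdeal R) _
      (by rw [Ideal.minimalPrimes_eq_subsingleton_self]; rfl)
  rw [← IsLocalRing.maximalIdeal_height_eq_ringKrullDim] at hdim
  have h2 : (IsLocalRing.maximalIdeal R).height = 2 := WithBot.coe_injective hdim
  rw [h2] at hle
  exact absurd hle (by decide)

theorem stmt_8 (R : Type*) [CommRing R] [IsDomain R] [IsNoetherianRing R] [IsLocalRing R]
    [IsAdicComplete (IsLocalRing.maximalIdeal R) R]
    (x y : R) (hxy : IsLocalRing.maximalIdeal R = Ideal.span {x, y})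
    (hdim : ringKrullDim R = 2)
    (hchar : ringChar (IsLocalRing.ResidueField R) ≠ 2)
    -- v is the discrete valuation on E = Frac R whose valuation ring is the localization
    -- of R at the height-one prime ideal (y)
    (v : Valuation (FractionRing R) (WithZero (Multiplicative ℤ)))
    (hv : Function.Surjective v)
    (hvring : ∀ e : FractionRing R, v e ≤ 1 ↔
      ∃ p q : R, q ∉ Ideal.span {y} ∧
        algebraMap R (FractionRing R) q * e = algebraMap R (FractionRing R) p)
    -- E_y is the completion of E with respect to v
    (Ey : Type*) [Field Ey] (ι : FractionRing R →+* Ey)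
    (w : Valuation Ey (WithZero (Multiplicative ℤ)))
    (hcompl : IsValuationCompletion v ι w)
    -- q = Σ aᵢ Zᵢ² is a diagonal quadratic form over E with aᵢ = x^{rᵢ} y^{sᵢ} uᵢ
    (n : ℕ) (a : Fin n → FractionRing R)
    (ha : ∀ i, ∃ (r s : ℕ) (u : Rˣ),
      a i = algebraMap R (FractionRing R) (x ^ r * y ^ s * (u : R)))
    -- if q is hyperbolic over E_y ...
    (hhyp : IsHyperbolicDiagonal (fun i => ι (a i))) :
    -- ... then q is hyperbolic over E
    IsHyperbolicDiagonal a := by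
  have hxm : x ∈ IsLocalRing.maximalIdeal R := hxy ▸ Ideal.subset_span (by simp)
  have hy : ¬IsUnit y := (hxy ▸ Ideal.subset_span (by simp) : y ∈ IsLocalRing.maximalIdeal R)
  have hring : HasValuationRingAt y v := hvring
  have hx : x ∉ Ideal.span {y} := notMem_span_singleton_of_ringKrullDim_eq_two hxy hdim
  have hy0 := hring.algebraMap_self_ne_zero hy hv
  have hx0 : algebraMap R (FractionRing R) x ≠ 0 := by
    rw [Ne, FaithfulSMul.algebraMap_eq_zero_iff]
    rintro rfl
    exact hx (zero_mem _)
  have hne : ∀ (r s : ℕ) (u : Rˣ), algebraMap R (FractionRing R) (x ^ r * y ^ s * u) ≠ 0 :=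
    fun r s u => by
      rw [map_mul, map_mul, map_pow, map_pow]
      exact mul_ne_zero (mul_ne_zero (pow_ne_zero _ hx0) (pow_ne_zero _ hy0))
        (u.isUnit.map _).ne_zero
  obtain ⟨m, hn, -⟩ := id hhyp
  choose r s u hru using ha
  let c : Fin n → FractionRing R := fun i =>
    algebraMap R (FractionRing R) (x ^ (r i % 2) * y ^ (s i % 2) * u i)
  have hac : DiagCongr c a := by
    convert DiagCongr.scale c
      (fun i => algebraMap R (FractionRing R) (x ^ (r i / 2) * y ^ (s i / 2) * (1 : Rˣ)))
      (fun i => hne _ _ _) using 1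
    ext i
    rw [hru, ← map_pow, ← map_mul]
    congr 1
    nth_rw 1 [← Nat.mod_add_div (r i) 2, ← Nat.mod_add_div (s i) 2]
    rw [pow_add, pow_add, pow_mul', pow_mul', Units.val_one]
    ring
  subst hn
  refine (hac.symm.trans ?_).isHyperbolicDiagonal rfl
  refine diagCongr_hyperbolicCoeff_of_hasIsotropicSubspace
    (isUnit_two_of_ringChar_residueField hchar) (algebraMap R (FractionRing R)) ι x y hx0 hy0
    ?_ m (Fin (2 * m)) (by simp) c
    (fun i => ⟨_, _, u i, Nat.mod_lt _ two_pos, Nat.mod_lt _ two_pos, rfl⟩)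
    ((hac.symm.map ι).hasIsotropicSubspace (hhyp.hasIsotropicSubspace rfl))
  rintro κ _ r s u hr hs ⟨z, hz, hz0⟩
  obtain ⟨t, i₀, hmax, hlt⟩ := hcompl.exists_approx _ (fun i => hne (r i) (s i) (u i)) hz hz0
  exact hring.exists_isotropic_residue hv hxy hx r s u hr hs t hmax hlt
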